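/- arXiv:2603.26979 — 2 statements merged into one kernel-verified Lean document; each statement's English description precedes it below -/
import Mathlib

section
/- Let d ≥ 1 and a, b > 0. Then the convolution of the Bessel kernels satisfies the semigroup property: (G_a ∗ G_b)(x) = G_{a+b}(x) for almost every x ∈ ℝ^d. -/
open MeasureTheory Real
open scoped ENNReal ComplexConjugate RealInnerProductSpace

/-- The Bessel kernel `G_s` on `ℝ^d`. -/
noncomputable def besselKernel (d : ℕ) (s : ℝ) (x : EuclideanSpace ℝ (Fin d)) : ℝ :=
  (4 * Real.pi) ^ (-(d : ℝ) / 2) * (Real.Gamma (s / 2))⁻¹ *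
    ∫ t in Set.Ioi (0 : ℝ), t ^ ((s - d) / 2 - 1) * Real.exp (-t) * Real.exp (-‖x‖ ^ 2 / (4 * t))

/-- The density of the gamma distribution with shape `α` and rate `1`, supported on `0 < t`. -/
noncomputable def gammaWeight (α t : ℝ) : ℝ≥0∞ :=
  ENNReal.ofReal (if 0 < t then (Gamma α)⁻¹ * t ^ (α - 1) * exp (-t) else 0)

/-- The heat kernel on `ℝ^d` at time `t`. -/
noncomputable def heatKernel (d : ℕ) (t : ℝ) (x : EuclideanSpace ℝ (Fin d)) : ℝ :=
  (4 * π * t) ^ (-(d : ℝ) / 2) * exp (-‖x‖ ^ 2 / (4 * t))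

/-- The Bessel kernel `G_s` as an extended nonnegative function. -/
noncomputable def lbesselKernel (d : ℕ) (s : ℝ) (x : EuclideanSpace ℝ (Fin d)) : ℝ≥0∞ :=
  ∫⁻ t : ℝ, gammaWeight (s / 2) t * ENNReal.ofReal (heatKernel d t x)

@[fun_prop]
theorem measurable_gammaWeight (α : ℝ) : Measurable (gammaWeight α) :=
  (Measurable.ite measurableSet_Ioi (by fun_prop) (by fun_prop)).ennreal_ofReal

@[fun_prop]
theorem measurable_heatKernel (d : ℕ) :
    Measurable fun p : ℝ × EuclideanSpace ℝ (Fin d) ↦ heatKernel d p.1 p.2 := by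
  unfold heatKernel
  fun_prop

@[fun_prop]
theorem measurable_lbesselKernel (d : ℕ) (s : ℝ) : Measurable (lbesselKernel d s) := by
  refine Measurable.lintegral_prod_right' (f := fun p : EuclideanSpace ℝ (Fin d) × ℝ ↦
    gammaWeight (s / 2) p.2 * ENNReal.ofReal (heatKernel d p.2 p.1)) ?_
  have h := (measurable_heatKernel d).comp
    (measurable_swap (α := EuclideanSpace ℝ (Fin d)) (β := ℝ))
  exact ((measurable_gammaWeight _).comp measurable_snd).mul h.ennreal_ofReal

theorem gammaWeight_of_nonpos (α : ℝ) {t : ℝ} (ht : t ≤ 0) : gammaWeight α t = 0 := by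
  simp [gammaWeight, ht.not_gt]

theorem lintegral_gammaWeight_ne_top {α : ℝ} (hα : 0 < α) : ∫⁻ t, gammaWeight α t ≠ ∞ := by
  refine ne_top_of_le_ne_top (b := 1) (by simp) ?_
  rw [← ProbabilityTheory.lintegral_gammaPDF_eq_one hα zero_lt_one]
  refine lintegral_mono fun t ↦ ?_
  rcases le_or_gt t 0 with h | h
  · simp [gammaWeight_of_nonpos _ h]
  · simp [gammaWeight, ProbabilityTheory.gammaPDF_eq, h, h.le]

theorem gammaWeight_mul_gammaWeight {α β : ℝ} (hα : 0 < α) (hβ : 0 < β) {u : ℝ} (hu : 0 < u)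
    (r : ℝ) :
    ENNReal.ofReal u * (gammaWeight α (u * r) * gammaWeight β (u - u * r)) =
      gammaWeight (α + β) u * ProbabilityTheory.betaPDF α β r := by
  by_cases hr : 0 < r ∧ r < 1
  · have h1 : 0 < u * r := mul_pos hu hr.1
    have h2 : u - u * r = u * (1 - r) := by ring
    have h4 : 0 < 1 - r := sub_pos.2 hr.2
    have h3 : 0 < u * (1 - r) := mul_pos hu h4
    have hΓα := Gamma_pos_of_pos hα
    have hΓβ := Gamma_pos_of_pos hβ
    have hΓ := Gamma_pos_of_pos (add_pos hα hβ)
    have hpow : u ^ (α + β - 1) = u * u ^ (α - 1) * u ^ (β - 1) := by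
      rw [← rpow_one_add' hu.le (by linarith), ← rpow_add hu]
      ring_nf
    have hexp : exp (-u) = exp (-(u * r)) * exp (-(u * (1 - r))) := by
      rw [← exp_add]
      ring_nf
    have hr0 := hr.1
    rw [h2, gammaWeight, gammaWeight, gammaWeight, ProbabilityTheory.betaPDF_eq, if_pos h1,
      if_pos h3, if_pos hu, if_pos hr, ← ENNReal.ofReal_mul (by positivity),
      ← ENNReal.ofReal_mul (by positivity), ← ENNReal.ofReal_mul (by positivity),
      mul_rpow hu.le hr.1.le, mul_rpow hu.le h4.le, hpow, hexp, ProbabilityTheory.beta]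
    congr 1
    field_simp
  · rw [ProbabilityTheory.betaPDF_eq, if_neg hr]
    rcases le_or_gt r 0 with h | h
    · simp [gammaWeight_of_nonpos α (mul_nonpos_of_nonneg_of_nonpos hu.le h)]
    · have : u - u * r ≤ 0 := by nlinarith [not_lt.1 fun h' ↦ hr ⟨h, h'⟩]
      simp [gammaWeight_of_nonpos β this]

theorem lintegral_gammaWeight_conv {α β : ℝ} (hα : 0 < α) (hβ : 0 < β) (u : ℝ) :
    ∫⁻ s, gammaWeight α s * gammaWeight β (u - s) = gammaWeight (α + β) u := by
  rcases le_or_gt u 0 with hu | hu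
  · rw [gammaWeight_of_nonpos _ hu, ← lintegral_zero (μ := (volume : Measure ℝ))]
    refine lintegral_congr fun s ↦ ?_
    rcases le_or_gt s 0 with hs | hs
    · simp [gammaWeight_of_nonpos α hs]
    · simp [gammaWeight_of_nonpos β (show u - s ≤ 0 by linarith)]
  · rw [← Real.smul_map_volume_mul_left hu.ne', lintegral_smul_measure,
      lintegral_map (by fun_prop) (by fun_prop), smul_eq_mul,
      ← lintegral_const_mul _ (by fun_prop), abs_of_pos hu]
    simp_rw [gammaWeight_mul_gammaWeight hα hβ hu]
    rw [lintegral_const_mul _ (by unfold ProbabilityTheory.betaPDF; fun_prop),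
      ProbabilityTheory.lintegral_betaPDF_eq_one hα hβ, mul_one]

theorem heatKernel_nonneg (d : ℕ) {t : ℝ} (ht : 0 ≤ t) (x : EuclideanSpace ℝ (Fin d)) :
    0 ≤ heatKernel d t x := by
  unfold heatKernel
  positivity

theorem lintegral_exp_neg_mul_sq_norm (d : ℕ) {c : ℝ} (hc : 0 < c) :
    ∫⁻ y : EuclideanSpace ℝ (Fin d), ENNReal.ofReal (exp (-c * ‖y‖ ^ 2)) =
      ENNReal.ofReal ((π / c) ^ ((d : ℝ) / 2)) := by
  have h := GaussianFourier.integral_rexp_neg_mul_sq_norm (V := EuclideanSpace ℝ (Fin d)) hc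
  rw [finrank_euclideanSpace_fin] at h
  rw [← h, ofReal_integral_eq_lintegral_ofReal]
  · refine Integrable.of_integral_ne_zero ?_
    rw [h]
    positivity
  · exact ae_of_all _ fun _ ↦ (exp_pos _).le

theorem lintegral_heatKernel (d : ℕ) {t : ℝ} (ht : 0 < t) :
    ∫⁻ x, ENNReal.ofReal (heatKernel d t x) = 1 := by
  have h (x : EuclideanSpace ℝ (Fin d)) : -‖x‖ ^ 2 / (4 * t) = -(1 / (4 * t)) * ‖x‖ ^ 2 := by ring
  have hp : (0 : ℝ) ≤ (4 * π * t) ^ (-(d : ℝ) / 2) := by positivity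
  simp_rw [heatKernel, h, ENNReal.ofReal_mul hp]
  rw [lintegral_const_mul _ (by fun_prop), lintegral_exp_neg_mul_sq_norm d (by positivity),
    ← ENNReal.ofReal_mul hp, show π / (1 / (4 * t)) = 4 * π * t by field_simp,
    ← rpow_add (by positivity)]
  simp [neg_div]

theorem heatKernel_mul_heatKernel (d : ℕ) {s t : ℝ} (hs : 0 < s) (ht : 0 < t)
    (x y : EuclideanSpace ℝ (Fin d)) :
    heatKernel d s (x - y) * heatKernel d t y =
      heatKernel d (s + t) x * heatKernel d (s * t / (s + t)) (y - (t / (s + t)) • x) := by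
  have hpow : (4 * π * s) ^ (-(d : ℝ) / 2) * (4 * π * t) ^ (-(d : ℝ) / 2) =
      (4 * π * (s + t)) ^ (-(d : ℝ) / 2) * (4 * π * (s * t / (s + t))) ^ (-(d : ℝ) / 2) := by
    rw [← mul_rpow (by positivity) (by positivity), ← mul_rpow (by positivity) (by positivity)]
    congr 1
    field_simp
  have hexp : -‖x - y‖ ^ 2 / (4 * s) + -‖y‖ ^ 2 / (4 * t) = -‖x‖ ^ 2 / (4 * (s + t)) +
      -‖y - (t / (s + t)) • x‖ ^ 2 / (4 * (s * t / (s + t))) := by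
    rw [norm_sub_sq_real, norm_sub_sq_real, norm_smul, inner_smul_right, real_inner_comm, mul_pow,
      norm_eq_abs, sq_abs]
    field_simp
    ring
  simp only [heatKernel]
  rw [mul_mul_mul_comm, hpow, ← exp_add, hexp, exp_add, mul_mul_mul_comm]

theorem lintegral_heatKernel_conv (d : ℕ) {s t : ℝ} (hs : 0 < s) (ht : 0 < t)
    (x : EuclideanSpace ℝ (Fin d)) :
    ∫⁻ y, ENNReal.ofReal (heatKernel d s (x - y)) * ENNReal.ofReal (heatKernel d t y) =
      ENNReal.ofReal (heatKernel d (s + t) x) := by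
  simp_rw [← ENNReal.ofReal_mul (heatKernel_nonneg d hs.le _), heatKernel_mul_heatKernel d hs ht,
    ENNReal.ofReal_mul (heatKernel_nonneg d (add_pos hs ht).le _)]
  rw [lintegral_const_mul _ (by fun_prop), lintegral_sub_right_eq_self
    (fun y ↦ ENNReal.ofReal (heatKernel d (s * t / (s + t)) y)),
    lintegral_heatKernel d (by positivity), mul_one]

theorem lintegral_lbesselKernel_ne_top (d : ℕ) {s : ℝ} (hs : 0 < s) :
    ∫⁻ x, lbesselKernel d s x ≠ ∞ := by
  unfold lbesselKernel
  rw [lintegral_lintegral_swap (by fun_prop)]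
  convert lintegral_gammaWeight_ne_top (half_pos hs) using 1
  refine lintegral_congr fun t ↦ ?_
  rw [lintegral_const_mul _ (by fun_prop)]
  rcases le_or_gt t 0 with h | h
  · simp [gammaWeight_of_nonpos _ h]
  · rw [lintegral_heatKernel d h, mul_one]

theorem lintegral_lbesselKernel_conv (d : ℕ) {a b : ℝ} (ha : 0 < a) (hb : 0 < b)
    (x : EuclideanSpace ℝ (Fin d)) :
    ∫⁻ y, lbesselKernel d a (x - y) * lbesselKernel d b y = lbesselKernel d (a + b) x := by
  have h1 (s t : ℝ) :
      ∫⁻ y, gammaWeight (a / 2) s * ENNReal.ofReal (heatKernel d s (x - y)) *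
        (gammaWeight (b / 2) t * ENNReal.ofReal (heatKernel d t y)) =
      gammaWeight (a / 2) s * gammaWeight (b / 2) t *
        ENNReal.ofReal (heatKernel d (s + t) x) := by
    simp_rw [mul_mul_mul_comm (gammaWeight (a / 2) s)]
    rw [lintegral_const_mul _ (by fun_prop)]
    rcases le_or_gt s 0 with hs | hs
    · simp [gammaWeight_of_nonpos _ hs]
    rcases le_or_gt t 0 with ht | ht
    · simp [gammaWeight_of_nonpos _ ht]
    rw [lintegral_heatKernel_conv d hs ht]
  calc
    _ = ∫⁻ y, ∫⁻ s, ∫⁻ t, gammaWeight (a / 2) s * ENNReal.ofReal (heatKernel d s (x - y)) *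
        (gammaWeight (b / 2) t * ENNReal.ofReal (heatKernel d t y)) := by
      refine lintegral_congr fun y ↦ ?_
      simp only [lbesselKernel]
      rw [← lintegral_mul_const _ (by fun_prop)]
      refine lintegral_congr fun s ↦ ?_
      rw [lintegral_const_mul _ (by fun_prop)]
    _ = ∫⁻ s, ∫⁻ t, gammaWeight (a / 2) s * gammaWeight (b / 2) t *
        ENNReal.ofReal (heatKernel d (s + t) x) := by
      rw [lintegral_lintegral_swap]
      · refine lintegral_congr fun s ↦ ?_
        rw [lintegral_lintegral_swap (by fun_prop)]
        exact lintegral_congr (h1 s)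
      · refine Measurable.aemeasurable ?_
        refine Measurable.lintegral_prod_right' (f := fun p : (EuclideanSpace ℝ (Fin d) × ℝ) × ℝ ↦
          gammaWeight (a / 2) p.1.2 * ENNReal.ofReal (heatKernel d p.1.2 (x - p.1.1)) *
          (gammaWeight (b / 2) p.2 * ENNReal.ofReal (heatKernel d p.2 p.1.1))) ?_
        fun_prop
    _ = ∫⁻ s, ∫⁻ u, gammaWeight (a / 2) s * gammaWeight (b / 2) (u - s) *
        ENNReal.ofReal (heatKernel d u x) := by
      refine lintegral_congr fun s ↦ ?_
      simpa using lintegral_add_left_eq_self (fun u ↦ gammaWeight (a / 2) s *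
        gammaWeight (b / 2) (u - s) * ENNReal.ofReal (heatKernel d u x)) s
    _ = lbesselKernel d (a + b) x := by
      rw [lintegral_lintegral_swap (by fun_prop)]
      refine lintegral_congr fun u ↦ ?_
      rw [lintegral_mul_const _ (by fun_prop),
        lintegral_gammaWeight_conv (half_pos ha) (half_pos hb), add_div]

theorem besselKernel_nonneg (d : ℕ) {s : ℝ} (hs : 0 < s) (x : EuclideanSpace ℝ (Fin d)) :
    0 ≤ besselKernel d s x := by
  have := Gamma_pos_of_pos (half_pos hs)
  refine mul_nonneg (by positivity) (setIntegral_nonneg measurableSet_Ioi fun t ht ↦ ?_)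
  have : 0 < t := ht
  positivity

theorem besselKernel_eq_toReal (d : ℕ) {s : ℝ} (hs : 0 < s) (x : EuclideanSpace ℝ (Fin d)) :
    besselKernel d s x = (lbesselKernel d s x).toReal := by
  have hΓ := Gamma_pos_of_pos (half_pos hs)
  have h : lbesselKernel d s x = ∫⁻ t in Set.Ioi (0 : ℝ),
      gammaWeight (s / 2) t * ENNReal.ofReal (heatKernel d t x) := by
    refine (setLIntegral_eq_of_support_subset fun t ht ↦ ?_).symm
    by_contra h
    exact ht (by simp [gammaWeight_of_nonpos _ (not_lt.1 h)])
  rw [h, besselKernel, ← integral_const_mul, integral_eq_lintegral_of_nonneg_ae]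
  · congr 1
    refine setLIntegral_congr_fun measurableSet_Ioi fun t (ht : 0 < t) ↦ ?_
    simp only [gammaWeight, heatKernel, if_pos ht]
    rw [← ENNReal.ofReal_mul (by positivity), mul_rpow (by positivity) ht.le,
      show (s - d) / 2 - 1 = (s / 2 - 1) + -(d : ℝ) / 2 by ring, rpow_add ht]
    congr 1
    ring
  · refine ae_restrict_of_forall_mem measurableSet_Ioi fun t (ht : 0 < t) ↦ ?_
    simp only [Pi.zero_apply]
    positivity
  · exact Measurable.aestronglyMeasurable (by fun_prop)

/-- Semigroup property of the Bessel kernels: `G_a ∗ G_b = G_{a+b}` a.e. -/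
theorem besselKernel_conv_semigroup
    (d : ℕ) (hd : 1 ≤ d) (a b : ℝ) (ha : 0 < a) (hb : 0 < b) :
    ∀ᵐ x : EuclideanSpace ℝ (Fin d) ∂(volume : Measure (EuclideanSpace ℝ (Fin d))),
      (∫ y : EuclideanSpace ℝ (Fin d), besselKernel d a (x - y) * besselKernel d b y)
        = besselKernel d (a + b) x := by
  refine ae_of_all _ fun x ↦ ?_
  have hmeas (s : ℝ) (hs : 0 < s) : Measurable (besselKernel d s) := by
    simp_rw [funext (besselKernel_eq_toReal d hs)]
    exact (measurable_lbesselKernel d s).ennreal_toReal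
  have hfin (s : ℝ) (hs : 0 < s) :
      ∀ᵐ y, ENNReal.ofReal (besselKernel d s y) = lbesselKernel d s y := by
    filter_upwards [ae_lt_top (measurable_lbesselKernel d s) (lintegral_lbesselKernel_ne_top d hs)]
      with y hy
    rw [besselKernel_eq_toReal d hs, ENNReal.ofReal_toReal hy.ne]
  rw [besselKernel_eq_toReal d (add_pos ha hb), ← lintegral_lbesselKernel_conv d ha hb,
    integral_eq_lintegral_of_nonneg_ae
      (ae_of_all _ fun y ↦ mul_nonneg (besselKernel_nonneg d ha _) (besselKernel_nonneg d hb _))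
      (((hmeas a ha).comp (by fun_prop)).mul (hmeas b hb)).aestronglyMeasurable]
  congr 1
  refine lintegral_congr_ae ?_
  filter_upwards [hfin b hb, (quasiMeasurePreserving_sub_left volume x).ae (hfin a ha)]
    with y hy1 hy2
  rw [ENNReal.ofReal_mul (besselKernel_nonneg d ha _), hy1, hy2]
end

section
/- Let 1 ≤ p, q ≤ ∞ and for each n ∈ ℕ let e_n denote the sequence that is 1 at n and 0 elsewhere (so e_n ∈ ℓ^p(ℕ) and e_n ∈ ℓ^q(ℕ)). There exists a continuous bilinear form B : ℓ^p(ℕ) × ℓ^q(ℕ) → ℝ such that B(f, e_m) = f(m) for all f ∈ ℓ^p(ℕ) and all m ∈ ℕ, and B(e_n, g) = g(n) for all g ∈ ℓ^q(ℕ) and all n ∈ ℕ, if and only if 1/p + 1/q ≥ 1 (with the convention 1/∞ = 0). (This says that ℓ^p and ℓ^q form an RKBS pair over ℕ with the Kronecker delta kernel K_ℕ(n,m) = 1 if n = m and 0 otherwise, exactly when 1/p + 1/q ≥ 1.) -/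
open scoped ENNReal

/-- The inclusion `ℓ^q ⊆ ℓ^r` for `q ≤ r`, as a continuous linear map. Continuity follows from the
closed graph theorem. -/
noncomputable def lpInclusionCLM {q r : ℝ≥0∞} [Fact (1 ≤ q)] [Fact (1 ≤ r)] (h : q ≤ r) :
    lp (fun _ : ℕ => ℝ) q →L[ℝ] lp (fun _ : ℕ => ℝ) r :=
  ⟨lp.linearMapOfLE ℝ (fun _ : ℕ => ℝ) h, by
    refine LinearMap.continuous_of_seq_closed_graph _ fun u x y hu hv => ?_
    ext i
    rw [lp.coe_linearMapOfLE_apply]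
    have hy := ((lp.evalCLM ℝ (fun _ : ℕ => ℝ) r i).continuous.tendsto y).comp hv
    have hx := ((lp.evalCLM ℝ (fun _ : ℕ => ℝ) q i).continuous.tendsto x).comp hu
    exact tendsto_nhds_unique hy hx⟩

lemma lpInclusionCLM_apply {q r : ℝ≥0∞} [Fact (1 ≤ q)] [Fact (1 ≤ r)] (h : q ≤ r)
    (g : lp (fun _ : ℕ => ℝ) q) (i : ℕ) : lpInclusionCLM h g i = g i := rfl

lemma norm_sum_range_lp_single_le (p : ℝ≥0∞) [hp : Fact (1 ≤ p)] (N : ℕ) :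
    ‖∑ i ∈ Finset.range N, lp.single (E := fun _ : ℕ => ℝ) p i (1 : ℝ)‖ ≤
      (N : ℝ) ^ (p⁻¹).toReal := by
  obtain rfl | hpt := eq_or_ne p ∞
  · refine lp.norm_le_of_forall_le (by positivity) fun i => ?_
    simp only [lp.coeFn_sum, lp.coeFn_single, Finset.sum_apply, Finset.sum_pi_single]
    split_ifs <;> simp
  · have hp0 : 0 < p.toReal := ENNReal.toReal_pos (zero_lt_one.trans_le hp.out).ne' hpt
    have h := lp.norm_sum_single (E := fun _ : ℕ => ℝ) hp0 (fun _ => (1 : ℝ)) (Finset.range N)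
    simp only [norm_one, Real.one_rpow, Finset.sum_const, Finset.card_range, nsmul_eq_mul,
      mul_one] at h
    rw [← h, ENNReal.toReal_inv, Real.rpow_rpow_inv (norm_nonneg _) hp0.ne']

/-- A bilinear form with the Kronecker delta kernel takes the value `N` at the pair of indicator
sequences of `{0, …, N - 1}`. -/
lemma apply_sum_range_lp_single {p q : ℝ≥0∞} [Fact (1 ≤ p)] [Fact (1 ≤ q)]
    (B : lp (fun _ : ℕ => ℝ) p →L[ℝ] lp (fun _ : ℕ => ℝ) q →L[ℝ] ℝ)
    (hB : ∀ (g : lp (fun _ : ℕ => ℝ) q) (n : ℕ), B (lp.single p n (1 : ℝ)) g = g n) (N : ℕ) :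
    B (∑ i ∈ Finset.range N, lp.single p i (1 : ℝ))
      (∑ i ∈ Finset.range N, lp.single q i (1 : ℝ)) = N := by
  rw [map_sum B, sum_apply]
  simp only [hB, lp.coeFn_sum, lp.coeFn_single, Finset.sum_apply, Finset.sum_pi_single]
  rw [Finset.sum_congr rfl fun i hi => if_pos hi]
  simp

lemma one_le_inv_add_inv_of_apply_lp_single {p q : ℝ≥0∞} [hp : Fact (1 ≤ p)] [hq : Fact (1 ≤ q)]
    (B : lp (fun _ : ℕ => ℝ) p →L[ℝ] lp (fun _ : ℕ => ℝ) q →L[ℝ] ℝ)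
    (hB : ∀ (g : lp (fun _ : ℕ => ℝ) q) (n : ℕ), B (lp.single p n (1 : ℝ)) g = g n) :
    1 ≤ p⁻¹ + q⁻¹ := by
  by_contra! hlt
  have hp' : p⁻¹ ≠ ∞ := ENNReal.inv_ne_top.2 (zero_lt_one.trans_le hp.out).ne'
  have hq' : q⁻¹ ≠ ∞ := ENNReal.inv_ne_top.2 (zero_lt_one.trans_le hq.out).ne'
  have hs : (p⁻¹).toReal + (q⁻¹).toReal < 1 := by
    rw [← ENNReal.toReal_add hp' hq', ← ENNReal.toReal_one]
    exact (ENNReal.toReal_lt_toReal (ENNReal.add_ne_top.2 ⟨hp', hq'⟩) ENNReal.one_ne_top).2 hlt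
  have hbound (N : ℕ) (hN : 0 < N) :
      (N : ℝ) ^ (1 - ((p⁻¹).toReal + (q⁻¹).toReal)) ≤ ‖B‖ := by
    have hN' : (0 : ℝ) < N := by exact_mod_cast hN
    rw [Real.rpow_sub hN', Real.rpow_one, div_le_iff₀ (by positivity), Real.rpow_add hN']
    calc (N : ℝ) = ‖B (∑ i ∈ Finset.range N, lp.single p i (1 : ℝ))
          (∑ i ∈ Finset.range N, lp.single q i (1 : ℝ))‖ := by
            rw [apply_sum_range_lp_single B hB N]; simp
      _ ≤ ‖B‖ * ‖∑ i ∈ Finset.range N, lp.single (E := fun _ : ℕ => ℝ) p i (1 : ℝ)‖ *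
          ‖∑ i ∈ Finset.range N, lp.single (E := fun _ : ℕ => ℝ) q i (1 : ℝ)‖ :=
            B.le_opNorm₂ _ _
      _ ≤ ‖B‖ * (N : ℝ) ^ (p⁻¹).toReal * (N : ℝ) ^ (q⁻¹).toReal := by
            gcongr
            · exact norm_sum_range_lp_single_le p N
            · exact norm_sum_range_lp_single_le q N
      _ = _ := mul_assoc _ _ _
  have htop := (tendsto_rpow_atTop (sub_pos.2 hs)).comp tendsto_natCast_atTop_atTop
  obtain ⟨N, hN, hN0⟩ :=
    ((htop.eventually_gt_atTop ‖B‖).and (Filter.eventually_gt_atTop 0)).exists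
  exact (hbound N hN0).not_gt hN

/-- `ℓ^p(ℕ)` and `ℓ^q(ℕ)` form an RKBS pair over `ℕ` with the Kronecker delta
kernel if and only if `1/p + 1/q ≥ 1`. -/
theorem lp_RKBS_pair_iff (p q : ℝ≥0∞) [Fact (1 ≤ p)] [Fact (1 ≤ q)] :
    (∃ B : lp (fun _ : ℕ => ℝ) p →L[ℝ] lp (fun _ : ℕ => ℝ) q →L[ℝ] ℝ,
      (∀ (f : lp (fun _ : ℕ => ℝ) p) (m : ℕ),
        B f (lp.single q m (1 : ℝ)) = f m) ∧
      (∀ (g : lp (fun _ : ℕ => ℝ) q) (n : ℕ),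
        B (lp.single p n (1 : ℝ)) g = g n)) ↔
    (1 : ℝ≥0∞) ≤ 1 / p + 1 / q := by
  simp only [one_div]
  constructor
  · rintro ⟨B, -, hB⟩
    exact one_le_inv_add_inv_of_apply_lp_single B hB
  · intro h
    let r : ℝ≥0∞ := p.conjExponent
    have : Fact (1 ≤ r) := ⟨ENNReal.HolderConjugate.one_le r p⟩
    have hqr : q ≤ r := by
      rw [← ENNReal.inv_le_inv, ← ENNReal.HolderConjugate.one_sub_inv p r]
      exact tsub_le_iff_left.2 h
    have hmul (_ : ℕ) : ‖ContinuousLinearMap.mul ℝ ℝ‖ ≤ (1 : NNReal) := by simp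
    let P := lp.dualPairing p r (fun _ : ℕ => ContinuousLinearMap.mul ℝ ℝ) hmul
    refine ⟨(ContinuousLinearMap.compL ℝ _ _ ℝ).flip (lpInclusionCLM hqr) ∘L P,
      fun f m => ?_, fun g n => ?_⟩
    · change ∑' i, f i * (lp.single q m (1 : ℝ) : lp (fun _ : ℕ => ℝ) q) i = f m
      rw [tsum_eq_single m fun i hi => by rw [lp.single_apply_ne _ _ _ hi, mul_zero],
        lp.single_apply_self, mul_one]
    · change ∑' i, (lp.single p n (1 : ℝ) : lp (fun _ : ℕ => ℝ) p) i * g i = g n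
      rw [tsum_eq_single n fun i hi => by rw [lp.single_apply_ne _ _ _ hi, zero_mul],
        lp.single_apply_self, one_mul]
end
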